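/- Let β satisfy 0 < β < 3 and let k satisfy 4/(4−β) < k < 3/(3−β). Then Q⁻⁺(k) = {(x,y,z) ∈ ℝ³ : β(x²y²+y²z²+z²x²) − (x²+y²+z²−1/2)² + (1−k)/4 = 0} has exactly eight connected components, and each of these components is compact and homeomorphic to the 2-sphere. -/

import Mathlib

open Set

/-! ### Connected components of a finite disjoint union of connected spaces -/

theorem connectedComponent_prod_discrete {ι S : Type*} [TopologicalSpace ι] [DiscreteTopology ι]
    [TopologicalSpace S] [ConnectedSpace S] (x : ι × S) :
    connectedComponent x = {x.1} ×ˢ univ := by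
  apply Subset.antisymm
  · intro y hy
    have h := (isPreconnected_connectedComponent (x := x)).image Prod.fst
      continuous_fst.continuousOn
    exact ⟨h.subsingleton ⟨y, hy, rfl⟩ ⟨x, mem_connectedComponent, rfl⟩, mem_univ _⟩
  · exact (isPreconnected_singleton.prod isPreconnected_univ).subset_connectedComponent
      ⟨rfl, mem_univ _⟩

theorem card_connectedComponents_prod_discrete {ι S : Type*} [TopologicalSpace ι]
    [DiscreteTopology ι] [TopologicalSpace S] [ConnectedSpace S] :
    Nat.card (ConnectedComponents (ι × S)) = Nat.card ι := by
  obtain ⟨s⟩ := (inferInstance : Nonempty S)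
  symm
  apply Nat.card_congr
  refine Equiv.ofBijective (fun i => ((i, s) : ConnectedComponents (ι × S))) ⟨?_, ?_⟩
  · intro i j hij
    have h := ConnectedComponents.coe_eq_coe'.1 hij
    rw [connectedComponent_prod_discrete] at h
    exact h.1
  · intro c
    obtain ⟨x, rfl⟩ := ConnectedComponents.surjective_coe c
    refine ⟨x.1, ConnectedComponents.coe_eq_coe'.2 ?_⟩
    rw [connectedComponent_prod_discrete]
    exact ⟨rfl, mem_univ _⟩

theorem Homeomorph.card_connectedComponents_eq {X Y : Type*} [TopologicalSpace X]
    [TopologicalSpace Y] (h : X ≃ₜ Y) :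
    Nat.card (ConnectedComponents X) = Nat.card (ConnectedComponents Y) := by
  have key (a b : X) : ((h a : Y) : ConnectedComponents Y) = (h b : Y) ↔
      (a : ConnectedComponents X) = b := by
    rw [ConnectedComponents.coe_eq_coe', ConnectedComponents.coe_eq_coe']
    constructor
    · intro hab
      have h1 := h.symm.continuous.image_connectedComponent_subset (h b) ⟨_, hab, rfl⟩
      simpa using h1
    · exact fun hab => h.continuous.image_connectedComponent_subset b ⟨_, hab, rfl⟩
  refine Nat.card_congr (Equiv.ofBijective h.continuous.connectedComponentsMap ⟨?_, ?_⟩)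
  · intro c d hcd
    obtain ⟨a, rfl⟩ := ConnectedComponents.surjective_coe c
    obtain ⟨b, rfl⟩ := ConnectedComponents.surjective_coe d
    exact (key a b).1 hcd
  · intro c
    obtain ⟨y, rfl⟩ := ConnectedComponents.surjective_coe c
    exact ⟨(h.symm y : X), congrArg _ (h.apply_symm_apply y)⟩

theorem Topology.IsEmbedding.connectedComponentIn_range {ι S Y : Type*} [TopologicalSpace ι]
    [DiscreteTopology ι] [TopologicalSpace S] [ConnectedSpace S] [TopologicalSpace Y]
    {f : ι × S → Y} (hf : Topology.IsEmbedding f) (x : ι × S) :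
    connectedComponentIn (range f) (f x) = range (fun s => f (x.1, s)) := by
  apply Subset.antisymm
  · intro y hy
    obtain ⟨⟨j, s⟩, rfl⟩ := connectedComponentIn_subset _ _ hy
    have hpre : IsPreconnected (f ⁻¹' connectedComponentIn (range f) (f x)) := by
      rw [← hf.isInducing.isPreconnected_image, image_preimage_eq_inter_range,
        inter_eq_left.2 (connectedComponentIn_subset _ _)]
      exact isPreconnected_connectedComponentIn
    have h := hpre.subset_connectedComponent (mem_connectedComponentIn (mem_range_self x)) hy
    rw [connectedComponent_prod_discrete] at h
    have hj : j = x.1 := h.1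
    exact ⟨s, by rw [hj]⟩
  · refine (isPreconnected_range (hf.continuous.comp (by fun_prop))).subset_connectedComponentIn
      ⟨x.2, rfl⟩ ?_
    rintro _ ⟨s, rfl⟩
    exact mem_range_self _

/-! ### The quartic in terms of squared coordinates -/

/-- The quadric that the squares of the coordinates of a point of the quartic satisfy. -/
def octahedralQuadric (β k a b c : ℝ) : Prop :=
  β * (a * b + b * c + c * a) - (a + b + c - 1 / 2) ^ 2 + (1 - k) / 4 = 0

theorem octahedralQuadric.pos_right {β k a b c : ℝ} (hβ0 : 0 < β) (hβ3 : β < 3)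
    (hk : 4 < k * (4 - β)) (h : octahedralQuadric β k a b c) : 0 < c := by
  unfold octahedralQuadric at h
  have hk0 : 0 < k := by nlinarith
  have hS : 0 < a + b + c := by
    nlinarith [mul_nonneg hβ0.le (add_nonneg (add_nonneg (sq_nonneg (a - b)) (sq_nonneg (b - c)))
      (sq_nonneg (c - a))), mul_nonneg (sub_nonneg.2 hβ3.le) (sq_nonneg (a + b + c))]
  by_contra! hc
  have hv : 4 * (a * b + b * c + c * a) ≤ (a + b + c) ^ 2 := by
    nlinarith [sq_nonneg (a - b), sq_nonneg c, mul_nonneg hS.le (neg_nonneg.2 hc)]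
  have h1 : 0 ≤ k * (β * (a + b + c) ^ 2 / 4 - (a + b + c) ^ 2 + (a + b + c) - k / 4) := by
    apply mul_nonneg hk0.le
    nlinarith [mul_le_mul_of_nonneg_left hv hβ0.le]
  nlinarith [sq_nonneg (a + b + c - k / 2), mul_pos (sub_pos.2 hk) (pow_pos hS 2)]

theorem octahedralQuadric.pos {β k a b c : ℝ} (hβ0 : 0 < β) (hβ3 : β < 3)
    (hk : 4 < k * (4 - β)) (h : octahedralQuadric β k a b c) : 0 < a ∧ 0 < b ∧ 0 < c := by
  refine ⟨pos_right (a := b) (b := c) hβ0 hβ3 hk ?_, pos_right (a := c) (b := a) hβ0 hβ3 hk ?_,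
    pos_right hβ0 hβ3 hk h⟩ <;>
  · unfold octahedralQuadric at h ⊢
    linarith

/-- Affine coordinates on `ℝ³` with axes along `(1, 1, 1)`, `(1, -1, 0)` and `(1, 1, -2)`. -/
noncomputable def axisCoord (s c₀ c₁ c₂ : ℝ) (q : EuclideanSpace ℝ (Fin 3)) : Fin 3 → ℝ :=
  ![(s + c₀ * q 0) / 3 + c₁ * q 1 + c₂ * q 2,
    (s + c₀ * q 0) / 3 - c₁ * q 1 + c₂ * q 2,
    (s + c₀ * q 0) / 3 - 2 * (c₂ * q 2)]

theorem continuous_axisCoord (s c₀ c₁ c₂ : ℝ) : Continuous (axisCoord s c₀ c₁ c₂) := by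
  refine continuous_pi fun i => ?_
  fin_cases i <;> simp only [axisCoord] <;> simp <;> fun_prop

theorem axisCoord_injective {s c₀ c₁ c₂ : ℝ} (h₀ : c₀ ≠ 0) (h₁ : c₁ ≠ 0) (h₂ : c₂ ≠ 0) :
    Function.Injective (axisCoord s c₀ c₁ c₂) := by
  intro p q h
  have e0 := congrFun h 0
  have e1 := congrFun h 1
  have e2 := congrFun h 2
  simp only [axisCoord, Matrix.cons_val] at e0 e1 e2
  ext i
  fin_cases i
  · exact mul_left_cancel₀ h₀ (show c₀ * p 0 = c₀ * q 0 by linarith)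
  · exact mul_left_cancel₀ h₁ (show c₁ * p 1 = c₁ * q 1 by linarith)
  · exact mul_left_cancel₀ h₂ (show c₂ * p 2 = c₂ * q 2 by linarith)

theorem exists_axisCoord_eq {s c₀ c₁ c₂ : ℝ} (h₀ : c₀ ≠ 0) (h₁ : c₁ ≠ 0) (h₂ : c₂ ≠ 0)
    (a : Fin 3 → ℝ) : ∃ q, axisCoord s c₀ c₁ c₂ q = a := by
  refine ⟨!₂[(a 0 + a 1 + a 2 - s) / c₀, (a 0 - a 1) / (2 * c₁),
    (a 0 + a 1 - 2 * a 2) / (6 * c₂)], ?_⟩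
  ext i
  fin_cases i <;> simp [axisCoord] <;> field_simp <;> ring

theorem mem_unitSphere_iff (q : EuclideanSpace ℝ (Fin 3)) :
    q ∈ Metric.sphere (0 : EuclideanSpace ℝ (Fin 3)) 1 ↔ q 0 ^ 2 + q 1 ^ 2 + q 2 ^ 2 = 1 := by
  rw [mem_sphere_zero_iff_norm, ← sq_eq_sq₀ (norm_nonneg _) zero_le_one,
    EuclideanSpace.real_norm_sq_eq, Fin.sum_univ_three, one_pow]

theorem octahedralQuadric_axisCoord_iff {β k m ρ c₀ c₁ c₂ : ℝ} (hm : m = 1 - β / 3)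
    (hm0 : m ≠ 0) (hρ : ρ = 1 / (4 * m) - k / 4) (hρ0 : ρ ≠ 0) (h₀ : m * c₀ ^ 2 = ρ)
    (h₁ : β * c₁ ^ 2 = ρ) (h₂ : 3 * β * c₂ ^ 2 = ρ) (q : EuclideanSpace ℝ (Fin 3)) :
    octahedralQuadric β k (axisCoord (1 / (2 * m)) c₀ c₁ c₂ q 0)
        (axisCoord (1 / (2 * m)) c₀ c₁ c₂ q 1) (axisCoord (1 / (2 * m)) c₀ c₁ c₂ q 2) ↔
      q ∈ Metric.sphere (0 : EuclideanSpace ℝ (Fin 3)) 1 := by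
  rw [mem_unitSphere_iff]
  simp only [octahedralQuadric, axisCoord, Matrix.cons_val]
  have hmm : m * (1 / (2 * m)) = 1 / 2 := by field_simp
  have hmm' : 1 / (4 * m) = 1 / (2 * m) / 2 := by field_simp; norm_num
  rw [hmm'] at hρ
  generalize 1 / (2 * m) = s at *
  have key : β * (((s + c₀ * q 0) / 3 + c₁ * q 1 + c₂ * q 2) *
        ((s + c₀ * q 0) / 3 - c₁ * q 1 + c₂ * q 2) +
      ((s + c₀ * q 0) / 3 - c₁ * q 1 + c₂ * q 2) * ((s + c₀ * q 0) / 3 - 2 * (c₂ * q 2)) +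
      ((s + c₀ * q 0) / 3 - 2 * (c₂ * q 2)) * ((s + c₀ * q 0) / 3 + c₁ * q 1 + c₂ * q 2)) -
      ((s + c₀ * q 0) / 3 + c₁ * q 1 + c₂ * q 2 + ((s + c₀ * q 0) / 3 - c₁ * q 1 + c₂ * q 2) +
        ((s + c₀ * q 0) / 3 - 2 * (c₂ * q 2)) - 1 / 2) ^ 2 + (1 - k) / 4 =
      ρ * (1 - (q 0 ^ 2 + q 1 ^ 2 + q 2 ^ 2)) := by
    have hb : β / 3 = 1 - m := by linarith
    linear_combination (s + c₀ * q 0) ^ 2 * hb - q 0 ^ 2 * h₀ - q 1 ^ 2 * h₁ - q 2 ^ 2 * h₂ -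
      (s + 2 * c₀ * q 0) * hmm - hρ
  rw [key, mul_eq_zero, or_iff_right hρ0, sub_eq_zero, eq_comm]

/-! ### Recovering the quartic from the quadric -/

/-- The real number `1` or `-1` encoded by a Boolean. -/
def boolSign (b : Bool) : ℝ := if b then 1 else -1

theorem boolSign_sq (b : Bool) : boolSign b ^ 2 = 1 := by cases b <;> simp [boolSign]

theorem eq_of_boolSign_mul_sqrt_eq {b b' : Bool} {x y : ℝ} (hx : 0 < x) (hy : 0 < y)
    (h : boolSign b * √x = boolSign b' * √y) : b = b' ∧ x = y := by
  have hx' := Real.sqrt_pos.2 hx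
  have hy' := Real.sqrt_pos.2 hy
  constructor
  · cases b <;> cases b' <;> simp [boolSign] at h ⊢ <;> linarith
  · have h2 := congrArg (· ^ 2) h
    simpa [mul_pow, boolSign_sq, Real.sq_sqrt hx.le, Real.sq_sqrt hy.le] using h2

theorem exists_boolSign_mul_sqrt_sq (x : ℝ) : ∃ b, boolSign b * √(x ^ 2) = x := by
  rw [Real.sqrt_sq_eq_abs]
  rcases le_total 0 x with h | h
  · exact ⟨true, by simp [boolSign, abs_of_nonneg h]⟩
  · exact ⟨false, by simp [boolSign, abs_of_nonpos h]⟩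

/-- The point with the signs `x.1` whose squared coordinates are `axisCoord s c₀ c₁ c₂ x.2`. -/
noncomputable def signedSqrtMap (s c₀ c₁ c₂ : ℝ)
    (x : (Fin 3 → Bool) × Metric.sphere (0 : EuclideanSpace ℝ (Fin 3)) 1) :
    EuclideanSpace ℝ (Fin 3) :=
  WithLp.toLp 2 fun i => boolSign (x.1 i) * √(axisCoord s c₀ c₁ c₂ x.2 i)

theorem continuous_signedSqrtMap (s c₀ c₁ c₂ : ℝ) : Continuous (signedSqrtMap s c₀ c₁ c₂) := by
  refine (PiLp.continuous_toLp 2 _).comp (continuous_pi fun i => ?_)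
  have hs : Continuous boolSign := continuous_of_discreteTopology
  exact (hs.comp ((continuous_apply i).comp continuous_fst)).mul
    (((continuous_apply i).comp ((continuous_axisCoord s c₀ c₁ c₂).comp
      (continuous_subtype_val.comp continuous_snd))).sqrt)

theorem signedSqrtMap_injective {s c₀ c₁ c₂ : ℝ} (h₀ : c₀ ≠ 0) (h₁ : c₁ ≠ 0) (h₂ : c₂ ≠ 0)
    (hpos : ∀ q ∈ Metric.sphere (0 : EuclideanSpace ℝ (Fin 3)) 1,
      ∀ i, 0 < axisCoord s c₀ c₁ c₂ q i) :
    Function.Injective (signedSqrtMap s c₀ c₁ c₂) := by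
  rintro ⟨e, q⟩ ⟨e', q'⟩ h
  have hi (i : Fin 3) := eq_of_boolSign_mul_sqrt_eq (hpos q q.2 i) (hpos q' q'.2 i)
    (congrFun (congrArg WithLp.ofLp h) i)
  exact Prod.ext (funext fun i => (hi i).1)
    (Subtype.ext (axisCoord_injective h₀ h₁ h₂ (funext fun i => (hi i).2)))

theorem range_signedSqrtMap {β k s c₀ c₁ c₂ : ℝ} (h₀ : c₀ ≠ 0) (h₁ : c₁ ≠ 0) (h₂ : c₂ ≠ 0)
    (hpos : ∀ q ∈ Metric.sphere (0 : EuclideanSpace ℝ (Fin 3)) 1,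
      ∀ i, 0 < axisCoord s c₀ c₁ c₂ q i)
    (hquad : ∀ q : EuclideanSpace ℝ (Fin 3),
      octahedralQuadric β k (axisCoord s c₀ c₁ c₂ q 0) (axisCoord s c₀ c₁ c₂ q 1)
        (axisCoord s c₀ c₁ c₂ q 2) ↔ q ∈ Metric.sphere (0 : EuclideanSpace ℝ (Fin 3)) 1) :
    range (signedSqrtMap s c₀ c₁ c₂) = {p | octahedralQuadric β k (p 0 ^ 2) (p 1 ^ 2) (p 2 ^ 2)} := by
  apply Subset.antisymm
  · rintro _ ⟨⟨e, q⟩, rfl⟩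
    have hsq (i : Fin 3) : signedSqrtMap s c₀ c₁ c₂ (e, q) i ^ 2 = axisCoord s c₀ c₁ c₂ q i := by
      simp [signedSqrtMap, mul_pow, boolSign_sq, Real.sq_sqrt (hpos q q.2 i).le]
    simpa only [mem_ofPred_eq, hsq] using (hquad q).2 q.2
  · intro p hp
    obtain ⟨q, hq⟩ := exists_axisCoord_eq (s := s) h₀ h₁ h₂ (fun i => p i ^ 2)
    choose e he using fun i => exists_boolSign_mul_sqrt_sq (p i)
    have hqS : q ∈ Metric.sphere (0 : EuclideanSpace ℝ (Fin 3)) 1 := by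
      rw [← hquad q, hq]
      exact hp
    refine ⟨(e, ⟨q, hqS⟩), ?_⟩
    ext i
    simp only [signedSqrtMap, hq, he]

/-- The quartic is an embedded disjoint union of eight copies of the sphere. -/
theorem exists_isEmbedding_range_eq_quartic {β k : ℝ} (hβ0 : 0 < β) (hβ3 : β < 3)
    (hk0 : 4 / (4 - β) < k) (hk1 : k < 3 / (3 - β)) :
    ∃ f : (Fin 3 → Bool) × Metric.sphere (0 : EuclideanSpace ℝ (Fin 3)) 1 →
        EuclideanSpace ℝ (Fin 3),
      Topology.IsEmbedding f ∧
        range f = {p | octahedralQuadric β k (p 0 ^ 2) (p 1 ^ 2) (p 2 ^ 2)} := by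
  have hk : 4 < k * (4 - β) := (div_lt_iff₀ (by linarith)).1 hk0
  obtain ⟨m, hm⟩ : ∃ m, m = 1 - β / 3 := ⟨_, rfl⟩
  obtain ⟨ρ, hρ⟩ : ∃ ρ, ρ = 1 / (4 * m) - k / 4 := ⟨_, rfl⟩
  have hm0 : 0 < m := by linarith
  have hρ0 : 0 < ρ := by
    have h3 : 3 / (3 - β) = 1 / m := by
      rw [hm, div_eq_div_iff (by linarith) (by linarith)]
      ring
    have h4 : 1 / (4 * m) = 1 / m / 4 := by field_simp
    rw [h3] at hk1
    rw [hρ, h4]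
    linarith
  have hc (d : ℝ) (hd : 0 < d) : √(ρ / d) ≠ 0 ∧ d * √(ρ / d) ^ 2 = ρ := by
    have hd' := div_pos hρ0 hd
    exact ⟨(Real.sqrt_pos.2 hd').ne', by rw [Real.sq_sqrt hd'.le]; field_simp⟩
  obtain ⟨h₀, e₀⟩ := hc m hm0
  obtain ⟨h₁, e₁⟩ := hc β hβ0
  obtain ⟨h₂, e₂⟩ := hc (3 * β) (by linarith)
  have hquad := octahedralQuadric_axisCoord_iff hm hm0.ne' hρ hρ0.ne' e₀ e₁ e₂
  have hpos (q : EuclideanSpace ℝ (Fin 3)) (hq : q ∈ Metric.sphere 0 1) (i : Fin 3) :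
      0 < axisCoord (1 / (2 * m)) (√(ρ / m)) (√(ρ / β)) (√(ρ / (3 * β))) q i := by
    obtain ⟨h1, h2, h3⟩ := ((hquad q).2 hq).pos hβ0 hβ3 hk
    fin_cases i
    exacts [h1, h2, h3]
  exact ⟨_, ((continuous_signedSqrtMap _ _ _ _).isClosedEmbedding
    (signedSqrtMap_injective h₀ h₁ h₂ hpos)).isEmbedding,
    range_signedSqrtMap h₀ h₁ h₂ hpos hquad⟩


/-- for `0 < β < 3` and `4/(4-β) < k < 3/(3-β)`, the quartic `Q⁻⁺(k)`
has exactly eight connected components, each compact and homeomorphic to the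
2-sphere. -/
theorem stmt_16 (β k : ℝ) (hβ0 : 0 < β) (hβ3 : β < 3)
    (hk0 : 4/(4-β) < k) (hk1 : k < 3/(3-β))
    (Q : Set (EuclideanSpace ℝ (Fin 3)))
    (hQ : Q = {p | β * ((p 0)^2*(p 1)^2 + (p 1)^2*(p 2)^2 + (p 2)^2*(p 0)^2)
        - ((p 0)^2 + (p 1)^2 + (p 2)^2 - 1/2)^2 + (1 - k)/4 = 0}) :
    Nat.card (ConnectedComponents ↥Q) = 8 ∧
    ∀ p ∈ Q, IsCompact (connectedComponentIn Q p) ∧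
      Nonempty (↥(connectedComponentIn Q p) ≃ₜ
        ↥(Metric.sphere (0 : EuclideanSpace ℝ (Fin 3)) 1)) := by
  have hS : IsConnected (Metric.sphere (0 : EuclideanSpace ℝ (Fin 3)) 1) :=
    isConnected_sphere (by rw [← Module.finrank_eq_rank, finrank_euclideanSpace_fin]; norm_num)
      0 zero_le_one
  have : ConnectedSpace (Metric.sphere (0 : EuclideanSpace ℝ (Fin 3)) 1) :=
    isConnected_iff_connectedSpace.1 hS
  obtain ⟨f, hf, hrange⟩ := exists_isEmbedding_range_eq_quartic hβ0 hβ3 hk0 hk1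
  have hQf : Q = range f := by
    rw [hQ, hrange]
    rfl
  subst hQf
  constructor
  · rw [← hf.toHomeomorph.card_connectedComponents_eq, card_connectedComponents_prod_discrete]
    simp
  · rintro _ ⟨x, rfl⟩
    have hemb := hf.comp (isEmbedding_prodMkRight x.1)
    rw [hf.connectedComponentIn_range x]
    exact ⟨isCompact_range hemb.continuous, ⟨hemb.toHomeomorph.symm⟩⟩
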